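/- arXiv:math/9502211 — 8 statements merged into one kernel-verified Lean document; each statement's English description precedes it below -/
import Mathlib

section
/- Let K be a field of characteristic zero and let Q be an arbitrary linear operator on the polynomial ring K[x]. Then there exists a unique sequence of polynomials (a_k)_{k≥0} in K[x] such that for every polynomial p, Q p = Σ_{k=0}^{deg p} a_k · p^{(k)}, where p^{(k)} denotes the k-th derivative of p. (That is, every linear operator on K[x] has a unique XD-expansion Q = Σ_k a_k(X) D^k with multiplication operators on the left and derivatives on the right.) -/
open Polynomial in
/-- The coefficients of the `XD`-expansion of `Q`, obtained by solving the triangular system given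
by the values of `Q` at the monomials. -/
noncomputable def xdCoeff {K : Type*} [Field K] (Q : Module.End K K[X]) (n : ℕ) : K[X] :=
  C (n.factorial : K)⁻¹ * (Q (X ^ n) - ∑ k : Fin n, xdCoeff Q k * derivative^[k] (X ^ n))
termination_by n
decreasing_by exact k.isLt

open Polynomial in
theorem Polynomial.iterate_derivative_X_pow_self {R : Type*} [CommSemiring R] (n : ℕ) :
    derivative^[n] (X ^ n : R[X]) = C (n.factorial : R) := by
  rw [iterate_derivative_X_pow_eq_C_mul, Nat.descFactorial_self, Nat.sub_self, pow_zero, mul_one]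

open Polynomial in
theorem map_X_pow_eq_sum_xdCoeff {K : Type*} [Field K] [CharZero K]
    (Q : Module.End K K[X]) (n : ℕ) :
    Q (X ^ n) = ∑ k ∈ Finset.range (n + 1), xdCoeff Q k * derivative^[k] (X ^ n) := by
  have hn : (n.factorial : K) ≠ 0 := Nat.cast_ne_zero.mpr n.factorial_ne_zero
  rw [Finset.sum_range_succ, iterate_derivative_X_pow_self, xdCoeff.eq_def Q n,
    Fin.sum_univ_eq_sum_range (fun k => xdCoeff Q k * derivative^[k] (X ^ n)) n,
    mul_right_comm, ← C_mul, inv_mul_cancel₀ hn, C_1, one_mul, add_sub_cancel]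

open Polynomial in
theorem sum_range_mul_iterate_derivative_eq {R : Type*} [CommSemiring R] (a : ℕ → R[X])
    {p : R[X]} {N : ℕ} (h : p.natDegree < N) :
    ∑ k ∈ Finset.range (p.natDegree + 1), a k * derivative^[k] p =
      ∑ k ∈ Finset.range N, a k * derivative^[k] p := by
  refine Finset.sum_subset (Finset.range_mono h) fun k _ hk => ?_
  rw [iterate_derivative_eq_zero (by simpa using hk), mul_zero]

/-- **XD-expansion formula** (Kurbanov–Maksimov / Pincherle–Amaldi).
Every linear operator `Q` on `K[x]` (`K` a field of characteristic zero) has a unique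
expansion `Q = ∑ₖ aₖ(X) Dᵏ` with multiplications on the left and derivatives on the right:
there is a unique sequence of polynomials `(aₖ)` such that
`Q p = ∑_{k=0}^{deg p} aₖ · p⁽ᵏ⁾` for every polynomial `p`. -/
theorem xd_expansion {K : Type*} [Field K] [CharZero K]
    (Q : Module.End K (Polynomial K)) :
    ∃! a : ℕ → Polynomial K, ∀ p : Polynomial K,
      Q p = ∑ k ∈ Finset.range (p.natDegree + 1),
        a k * Polynomial.derivative^[k] p := by
  open Polynomial in
  refine ⟨xdCoeff Q, fun p => ?_, fun b hb => funext fun n => ?_⟩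
  · have hmono (i : ℕ) (hi : i ∈ Finset.range (p.natDegree + 1)) :
        Q (X ^ i) = ∑ k ∈ Finset.range (p.natDegree + 1),
          xdCoeff Q k * derivative^[k] (X ^ i) := by
      have hdeg : (X ^ i : K[X]).natDegree < p.natDegree + 1 := by simpa using hi
      rw [map_X_pow_eq_sum_xdCoeff, ← sum_range_mul_iterate_derivative_eq _ hdeg, natDegree_X_pow]
    have hp : p = ∑ i ∈ Finset.range (p.natDegree + 1), p.coeff i • X ^ i := by
      simpa only [smul_eq_C_mul] using p.as_sum_range_C_mul_X_pow
    generalize p.natDegree + 1 = N at hmono hp ⊢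
    rw [hp]
    simp only [map_sum, map_smul, iterate_derivative_sum, iterate_derivative_smul,
      Finset.mul_sum, mul_smul_comm]
    rw [Finset.sum_comm]
    refine Finset.sum_congr rfl fun i hi => ?_
    rw [hmono i hi, Finset.smul_sum]
  · induction n using Nat.strong_induction_on with
    | _ n ih =>
      have hn : C (n.factorial : K) ≠ 0 :=
        C_ne_zero.mpr (Nat.cast_ne_zero.mpr n.factorial_ne_zero)
      have h := hb (X ^ n)
      rw [natDegree_X_pow, map_X_pow_eq_sum_xdCoeff, Finset.sum_range_succ, Finset.sum_range_succ,
        Finset.sum_congr rfl fun k hk => by rw [← ih k (Finset.mem_range.mp hk)],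
        iterate_derivative_X_pow_self] at h
      exact (mul_right_cancel₀ hn (add_left_cancel h)).symm
end

section
/- Let K be a field of characteristic zero, let B be a degree reducing linear operator on K[x] with divided power sequence (b_n)_{n≥0}, and let Q be an arbitrary linear operator on K[x]. Then there exists a unique sequence of polynomials (a_k)_{k≥0} in K[x] such that for every polynomial p, Q p = Σ_{k=0}^{deg p} a_k · (B^k p); moreover these coefficients satisfy, for every n ≥ 0, the identity Σ_{k=0}^{n} a_k · b_{n−k} = Q b_n. -/
/-- A linear operator `B` on `K[x]` is *degree reducing* if it kills constants and
lowers the degree of every nonconstant polynomial by exactly one. -/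
def DegreeReducing {K : Type*} [Field K] (B : Module.End K (Polynomial K)) : Prop :=
  (∀ c : K, B (Polynomial.C c) = 0) ∧
    ∀ p : Polynomial K, 0 < p.degree → (B p).degree + 1 = p.degree

/-- `b` is the divided power sequence of `B`: `B b₀ = 0`, `B bₙ = bₙ₋₁`, `bₙ(0) = δₙ₀`. -/
def IsDividedPowerSeq {K : Type*} [Field K] (B : Module.End K (Polynomial K))
    (b : ℕ → Polynomial K) : Prop :=
  B (b 0) = 0 ∧ (∀ n : ℕ, B (b (n + 1)) = b n) ∧
    ∀ n : ℕ, (b n).eval 0 = if n = 0 then 1 else 0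

open Polynomial

theorem DegreeReducing.eq_C_of_apply_eq_zero {K : Type*} [Field K] {B : Module.End K K[X]}
    (hB : DegreeReducing B) {p : K[X]} (hp : B p = 0) : p = C (p.coeff 0) := by
  refine eq_C_of_degree_le_zero (not_lt.mp fun hpos => ?_)
  have h := hB.2 p hpos
  rw [hp, degree_zero, WithBot.bot_add] at h
  simp [← h] at hpos

theorem DegreeReducing.pow_apply_eq_zero {K : Type*} [Field K] {B : Module.End K K[X]}
    (hB : DegreeReducing B) {k : ℕ} {p : K[X]} (hp : p.degree < k) : (B ^ k) p = 0 := by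
  induction k generalizing p with
  | zero => simpa using hp
  | succ k ih =>
    rw [pow_succ, Module.End.mul_apply]
    by_cases hpos : 0 < p.degree
    · apply ih
      rw [← hB.2 p hpos] at hp
      push_cast at hp
      exact lt_of_add_lt_add_right hp
    · rw [eq_C_of_degree_le_zero (not_lt.mp hpos), hB.1, map_zero]

/-- The sum `∑ aₖ · (Bᵏ p)` does not change when terms beyond `deg p` are included. -/
theorem DegreeReducing.sum_range_eq {K : Type*} [Field K] {B : Module.End K K[X]}
    (hB : DegreeReducing B) (a : ℕ → K[X]) {p : K[X]} {N : ℕ} (hN : p.natDegree + 1 ≤ N) :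
    ∑ k ∈ Finset.range N, a k * (B ^ k) p =
      ∑ k ∈ Finset.range (p.natDegree + 1), a k * (B ^ k) p := by
  refine (Finset.sum_subset (Finset.range_mono hN) fun k _ hk => ?_).symm
  rw [hB.pow_apply_eq_zero, mul_zero]
  refine degree_le_natDegree.trans_lt (Nat.cast_lt.mpr ?_)
  simpa using hk

theorem IsDividedPowerSeq.apply_zero {K : Type*} [Field K] {B : Module.End K K[X]}
    (hB : DegreeReducing B) {b : ℕ → K[X]} (hb : IsDividedPowerSeq B b) : b 0 = 1 := by
  have h := hB.eq_C_of_apply_eq_zero hb.1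
  have h0 := hb.2.2 0
  rw [← coeff_zero_eq_eval_zero] at h0
  rw [h, h0]
  simp

theorem IsDividedPowerSeq.degree_eq {K : Type*} [Field K] {B : Module.End K K[X]}
    (hB : DegreeReducing B) {b : ℕ → K[X]} (hb : IsDividedPowerSeq B b) (n : ℕ) :
    (b n).degree = n := by
  induction n with
  | zero => simp [hb.apply_zero hB]
  | succ n ih =>
    have hpos : 0 < (b (n + 1)).degree := by
      by_contra h
      have h0 := hb.2.1 n
      rw [eq_C_of_degree_le_zero (not_lt.mp h), hB.1] at h0
      simp [← h0] at ih
    rw [← hB.2 _ hpos, hb.2.1, ih]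
    rfl

theorem IsDividedPowerSeq.pow_apply {K : Type*} [Field K] {B : Module.End K K[X]}
    {b : ℕ → K[X]} (hb : IsDividedPowerSeq B b) {k n : ℕ} (hk : k ≤ n) :
    (B ^ k) (b n) = b (n - k) := by
  obtain ⟨m, rfl⟩ := Nat.exists_eq_add_of_le' hk
  rw [Nat.add_sub_cancel]
  clear hk
  induction k with
  | zero => simp
  | succ k ih => rw [pow_succ, Module.End.mul_apply, ← add_assoc, hb.2.1, ih]

theorem IsDividedPowerSeq.span_range {K : Type*} [Field K] {B : Module.End K K[X]}
    (hB : DegreeReducing B) {b : ℕ → K[X]} (hb : IsDividedPowerSeq B b) :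
    Submodule.span K (Set.range b) = ⊤ := by
  let S : Polynomial.Sequence K := ⟨b, hb.degree_eq hB⟩
  exact S.span fun n => (leadingCoeff_ne_zero.mpr (S.ne_zero n)).isUnit

/-- Convolution equations with leading coefficient one are uniquely solvable. -/
theorem existsUnique_sum_range_mul_eq {R : Type*} [CommRing R] {b : ℕ → R} (hb : b 0 = 1)
    (q : ℕ → R) :
    ∃! a : ℕ → R, ∀ n, ∑ k ∈ Finset.range (n + 1), a k * b (n - k) = q n := by
  have key (a : ℕ → R) : (∀ n, ∑ k ∈ Finset.range (n + 1), a k * b (n - k) = q n) ↔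
      PowerSeries.mk a * PowerSeries.mk b = PowerSeries.mk q := by
    simp [PowerSeries.ext_iff, PowerSeries.coeff_mul,
      Finset.Nat.sum_antidiagonal_eq_sum_range_succ fun i j => a i * b j]
  have hu : IsUnit (PowerSeries.mk b) := by
    rw [PowerSeries.isUnit_iff_constantCoeff, ← PowerSeries.coeff_zero_eq_constantCoeff_apply,
      PowerSeries.coeff_mk, hb]
    exact isUnit_one
  obtain ⟨u, hu'⟩ := hu.exists_left_inv
  refine ⟨fun n => PowerSeries.coeff n (PowerSeries.mk q * u), (key _).mpr ?_, fun a ha => ?_⟩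
  · have h : (PowerSeries.mk fun n => PowerSeries.coeff n (PowerSeries.mk q * u)) =
        PowerSeries.mk q * u := by
      ext; simp
    rw [h, mul_assoc, hu', mul_one]
  · funext n
    rw [← (key a).mp ha, mul_assoc, mul_comm _ u, hu', mul_one, PowerSeries.coeff_mk]

/-- An expansion in powers of `B` may be tested on the divided power sequence. -/
theorem IsDividedPowerSeq.expansion_iff {K : Type*} [Field K] {B : Module.End K K[X]}
    (hB : DegreeReducing B) {b : ℕ → K[X]} (hb : IsDividedPowerSeq B b)
    (Q : Module.End K K[X]) (a : ℕ → K[X]) :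
    (∀ p : K[X], Q p = ∑ k ∈ Finset.range (p.natDegree + 1), a k * (B ^ k) p) ↔
      ∀ n : ℕ, ∑ k ∈ Finset.range (n + 1), a k * b (n - k) = Q (b n) := by
  have hsum (n : ℕ) : ∑ k ∈ Finset.range (n + 1), a k * b (n - k) =
      ∑ k ∈ Finset.range ((b n).natDegree + 1), a k * (B ^ k) (b n) := by
    rw [natDegree_eq_of_degree_eq_some (hb.degree_eq hB n)]
    refine Finset.sum_congr rfl fun k hk => ?_
    rw [hb.pow_apply (Nat.lt_succ_iff.mp (Finset.mem_range.mp hk))]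
  refine ⟨fun h n => (hsum n).trans (h (b n)).symm, fun h p => ?_⟩
  suffices H : ∃ M, ∀ N ≥ M, Q p = ∑ k ∈ Finset.range N, a k * (B ^ k) p by
    obtain ⟨M, hM⟩ := H
    rw [hM (max M (p.natDegree + 1)) (le_max_left _ _), hB.sum_range_eq a (le_max_right _ _)]
  have hp : p ∈ Submodule.span K (Set.range b) := by simp [hb.span_range hB]
  induction hp using Submodule.span_induction with
  | mem x hx =>
    obtain ⟨n, rfl⟩ := hx
    exact ⟨_, fun N hN => by rw [hB.sum_range_eq a hN, ← hsum, h]⟩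
  | zero => exact ⟨0, by simp⟩
  | add x y _ _ hx hy =>
    obtain ⟨M, hM⟩ := hx
    obtain ⟨M', hM'⟩ := hy
    refine ⟨max M M', fun N hN => ?_⟩
    rw [map_add, hM N (le_of_max_le_left hN), hM' N (le_of_max_le_right hN)]
    simp [mul_add, Finset.sum_add_distrib]
  | smul c x _ hx =>
    obtain ⟨M, hM⟩ := hx
    refine ⟨M, fun N hN => ?_⟩
    rw [map_smul, hM N hN]
    simp [Finset.smul_sum]


/-- **XB-expansion formula.**  For a degree reducing operator `B` with divided power
sequence `(bₙ)`, every linear operator `Q` on `K[x]` has a unique expansion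
`Q p = ∑_{k=0}^{deg p} aₖ · (Bᵏ p)`, and the coefficients satisfy
`∑_{k=0}^{n} aₖ · bₙ₋ₖ = Q bₙ` for all `n`. -/
theorem xb_expansion {K : Type*} [Field K] [CharZero K]
    (B : Module.End K (Polynomial K)) (hB : DegreeReducing B)
    (b : ℕ → Polynomial K) (hb : IsDividedPowerSeq B b)
    (Q : Module.End K (Polynomial K)) :
    (∃! a : ℕ → Polynomial K, ∀ p : Polynomial K,
        Q p = ∑ k ∈ Finset.range (p.natDegree + 1), a k * (B ^ k) p) ∧
      ∀ a : ℕ → Polynomial K,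
        (∀ p : Polynomial K,
            Q p = ∑ k ∈ Finset.range (p.natDegree + 1), a k * (B ^ k) p) →
          ∀ n : ℕ, ∑ k ∈ Finset.range (n + 1), a k * b (n - k) = Q (b n) := by
  simp only [hb.expansion_iff hB Q]
  exact ⟨existsUnique_sum_range_mul_eq (hb.apply_zero hB) fun n => Q (b n), fun _ ha => ha⟩
end

section
/- Let K be a field of characteristic zero, let m be a positive integer, and let Q be an arbitrary linear operator on the multivariate polynomial ring K[x_1,…,x_m]. Then there exists a unique family of polynomials (a_k) indexed by multi-indices k = (k_1,…,k_m) of nonnegative integers such that for every polynomial p, Q p = Σ_k a_k · (∂_1^{k_1} ⋯ ∂_m^{k_m} p), where ∂_i denotes the partial derivative with respect to x_i; the sum is finite since ∂^k p = 0 whenever k_i exceeds the degree of p in x_i for some i. -/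
/-- The composite partial-derivative operator `∂^k = ∂₁^{k₁} ⋯ ∂ₘ^{kₘ}` on
multivariate polynomials, for a multi-index `k : Fin m → ℕ`. -/
noncomputable def pderivPow {K : Type*} [CommSemiring K] {m : ℕ} (k : Fin m → ℕ)
    (p : MvPolynomial (Fin m) K) : MvPolynomial (Fin m) K :=
  (List.finRange m).foldr (fun i q => (⇑(MvPolynomial.pderiv i))^[k i] q) p

open MvPolynomial in
theorem iterate_pderiv_monomial {σ R : Type*} [CommSemiring R] (i : σ) (n : ℕ) (s : σ →₀ ℕ)
    (c : R) :
    (⇑(pderiv i))^[n] (monomial s c) =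
      monomial (s - Finsupp.single i n) (c * ((s i).descFactorial n : R)) := by
  induction n with
  | zero => simp
  | succ n ih =>
    rw [Function.iterate_succ_apply', ih, pderiv_monomial, tsub_tsub, ← Finsupp.single_add,
      Nat.descFactorial_succ]
    congr 1
    simp only [Finsupp.tsub_apply, Finsupp.single_eq_same]
    push_cast
    ring

open MvPolynomial in
theorem foldr_iterate_pderiv_monomial {σ R : Type*} [CommSemiring R] (k : σ → ℕ) (s : σ →₀ ℕ)
    (c : R) {l : List σ} (hl : l.Nodup) :
    l.foldr (fun i q => (⇑(pderiv i))^[k i] q) (monomial s c) =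
      monomial (s - (l.map fun i => Finsupp.single i (k i)).sum)
        (c * (l.map fun i => ((s i).descFactorial (k i) : R)).prod) := by
  induction l with
  | nil => simp
  | cons i l ih =>
    obtain ⟨hi, hl'⟩ := List.nodup_cons.mp hl
    have hsum : (l.map fun j => Finsupp.single j (k j)).sum i = 0 := by
      clear ih hl hl'
      induction l with
      | nil => simp
      | cons j l ih =>
        simp only [List.mem_cons, not_or] at hi
        simp [ih hi.2, Finsupp.single_eq_of_ne hi.1]
    rw [List.foldr_cons, ih hl', iterate_pderiv_monomial, Finsupp.tsub_apply, hsum, tsub_zero,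
      tsub_tsub, List.map_cons, List.map_cons, List.sum_cons, List.prod_cons]
    congr 1
    · rw [add_comm]
    · ring

open MvPolynomial in
theorem pderivPow_monomial {R : Type*} [CommSemiring R] {m : ℕ} (k : Fin m → ℕ)
    (s : Fin m →₀ ℕ) (c : R) :
    pderivPow k (monomial s c) =
      monomial (s - ∑ i, Finsupp.single i (k i)) (c * ∏ i, ((s i).descFactorial (k i) : R)) := by
  rw [pderivPow, foldr_iterate_pderiv_monomial k s c (List.nodup_finRange m),
    Fin.sum_univ_def, Fin.prod_univ_def]

open MvPolynomial in
theorem pderivPow_monomial_of_not_le {R : Type*} [CommSemiring R] {m : ℕ} {k : Fin m → ℕ}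
    {s : Fin m →₀ ℕ} (h : ¬ k ≤ s) (c : R) : pderivPow k (monomial s c) = 0 := by
  obtain ⟨i, hi⟩ := not_forall.mp h
  rw [pderivPow_monomial, Finset.prod_eq_zero (Finset.mem_univ i), mul_zero, monomial_zero]
  rw [Nat.descFactorial_of_lt (not_le.mp hi), Nat.cast_zero]

open MvPolynomial in
theorem pderivPow_monomial_self {R : Type*} [CommSemiring R] {m : ℕ} (s : Fin m →₀ ℕ) (c : R) :
    pderivPow s (monomial s c) = C (c * ∏ i, ((s i).factorial : R)) := by
  rw [pderivPow_monomial, Finsupp.univ_sum_single, tsub_self]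
  simp only [Nat.descFactorial_self]
  rfl

/-- The operator `pderivPow k`, bundled as a linear map. -/
noncomputable def pderivPowLinearMap {R : Type*} [CommSemiring R] {m : ℕ} (k : Fin m → ℕ) :
    Module.End R (MvPolynomial (Fin m) R) where
  toFun := pderivPow k
  map_add' p q := by
    unfold pderivPow
    induction List.finRange m with
    | nil => rfl
    | cons i l ih => rw [List.foldr_cons, ih, iterate_map_add]; rfl
  map_smul' c p := by
    unfold pderivPow
    induction List.finRange m with
    | nil => rfl
    | cons i l ih =>
      rw [List.foldr_cons, ih, RingHom.id_apply, ← Derivation.coeFn_coe, ← Module.End.coe_pow,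
        map_smul, Module.End.coe_pow]
      rfl

theorem pderivPow_add {R : Type*} [CommSemiring R] {m : ℕ} (k : Fin m → ℕ)
    (p q : MvPolynomial (Fin m) R) : pderivPow k (p + q) = pderivPow k p + pderivPow k q :=
  (pderivPowLinearMap k).map_add p q

theorem finite_support_mul_pderivPow {R : Type*} [CommSemiring R] {m : ℕ}
    (a : (Fin m → ℕ) → MvPolynomial (Fin m) R) (p : MvPolynomial (Fin m) R) :
    (Function.support fun k => a k * pderivPow k p).Finite := by
  induction p using MvPolynomial.induction_on' with
  | monomial s c =>
    refine (Set.finite_Iic (s : Fin m → ℕ)).subset fun k hk => ?_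
    by_contra h
    exact hk (by simp only [pderivPow_monomial_of_not_le h, mul_zero])
  | add p q hp hq =>
    simp only [pderivPow_add, mul_add]
    exact (hp.union hq).subset (Function.support_add _ _)

/-- The operator `p ↦ ∑ a_k ∂^k p` with polynomial coefficients `a`. -/
noncomputable def diffOperator {R : Type*} [CommSemiring R] {m : ℕ}
    (a : (Fin m → ℕ) → MvPolynomial (Fin m) R) : Module.End R (MvPolynomial (Fin m) R) where
  toFun p := ∑ᶠ k, a k * pderivPow k p
  map_add' p q := by
    rw [← finsum_add_distrib (finite_support_mul_pderivPow a p)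
      (finite_support_mul_pderivPow a q)]
    simp only [pderivPow_add, mul_add]
  map_smul' c p := by
    rw [RingHom.id_apply, smul_finsum' c (finite_support_mul_pderivPow a p)]
    exact finsum_congr fun k => by
      rw [show pderivPow k (c • p) = c • pderivPow k p from (pderivPowLinearMap k).map_smul c p,
        mul_smul_comm]

open MvPolynomial in
theorem diffOperator_monomial {R : Type*} [CommSemiring R] {m : ℕ}
    (a : (Fin m → ℕ) → MvPolynomial (Fin m) R) (s : Fin m →₀ ℕ) :
    diffOperator a (monomial s 1) =
      ∑ k ∈ Finset.Iio (s : Fin m → ℕ), a k * pderivPow k (monomial s 1) +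
        a s * C (∏ i, ((s i).factorial : R)) := by
  have h : diffOperator a (monomial s 1) =
      ∑ k ∈ Finset.Iic (s : Fin m → ℕ), a k * pderivPow k (monomial s 1) :=
    finsum_eq_sum_of_support_subset _ fun k hk => by
      by_contra h
      exact hk (by simp only [pderivPow_monomial_of_not_le (by simpa using h), mul_zero])
  rw [h, ← Finset.Iio_insert, Finset.sum_insert (by simp), pderivPow_monomial_self, one_mul,
    add_comm]

theorem prod_factorial_cast_ne_zero {K ι : Type*} [Field K] [CharZero K] [Fintype ι]
    (s : ι → ℕ) : ∏ i, ((s i).factorial : K) ≠ 0 :=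
  Finset.prod_ne_zero_iff.mpr fun i _ => Nat.cast_ne_zero.mpr (s i).factorial_ne_zero

theorem diffOperator_injective {K : Type*} [Field K] [CharZero K] {m : ℕ} :
    Function.Injective (diffOperator (R := K) (m := m)) := by
  intro a b hab
  funext s
  induction s using WellFoundedLT.induction with
  | ind s ih =>
    have h := DFunLike.congr_fun hab
      (MvPolynomial.monomial (Finsupp.equivFunOnFinite.symm s) 1)
    rw [diffOperator_monomial, diffOperator_monomial,
      Finset.sum_congr rfl fun k hk => by rw [ih k (by simpa using hk)]] at h
    refine mul_right_cancel₀ ?_ (add_left_cancel h)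
    exact (map_ne_zero_iff _ (MvPolynomial.C_injective _ _)).mpr (prod_factorial_cast_ne_zero _)

/-- The coefficients of the expansion of `Q`, determined recursively by the values of `Q` on
monomials. -/
noncomputable def expansionCoeff {K : Type*} [Field K] {m : ℕ}
    (Q : Module.End K (MvPolynomial (Fin m) K)) : (Fin m → ℕ) → MvPolynomial (Fin m) K :=
  (wellFounded_lt (α := Fin m → ℕ)).fix fun s a =>
    (Q (MvPolynomial.monomial (Finsupp.equivFunOnFinite.symm s) 1) -
      ∑ k : Finset.Iio s, a k (Finset.mem_Iio.mp k.2) *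
        pderivPow k (MvPolynomial.monomial (Finsupp.equivFunOnFinite.symm s) 1)) *
      MvPolynomial.C (∏ i, ((s i).factorial : K))⁻¹

theorem expansionCoeff_eq {K : Type*} [Field K] {m : ℕ}
    (Q : Module.End K (MvPolynomial (Fin m) K)) (s : Fin m →₀ ℕ) :
    expansionCoeff Q s = (Q (MvPolynomial.monomial s 1) -
      ∑ k ∈ Finset.Iio (s : Fin m → ℕ),
        expansionCoeff Q k * pderivPow k (MvPolynomial.monomial s 1)) *
      MvPolynomial.C (∏ i, ((s i).factorial : K))⁻¹ := by
  rw [← Finset.sum_coe_sort]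
  conv_lhs => rw [expansionCoeff, WellFounded.fix_eq]
  simp only [Finsupp.equivFunOnFinite_symm_coe]
  rfl

theorem diffOperator_expansionCoeff {K : Type*} [Field K] [CharZero K] {m : ℕ}
    (Q : Module.End K (MvPolynomial (Fin m) K)) : diffOperator (expansionCoeff Q) = Q := by
  refine MvPolynomial.linearMap_ext fun s => LinearMap.ext_ring ?_
  rw [LinearMap.comp_apply, LinearMap.comp_apply, diffOperator_monomial, expansionCoeff_eq Q s,
    mul_assoc, ← map_mul, inv_mul_cancel₀ (prod_factorial_cast_ne_zero _), MvPolynomial.C_1, mul_one,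
    add_sub_cancel]

/-- **Multivariate XD-expansion formula.**  Every linear operator `Q` on
`K[x₁,…,xₘ]` (`K` of characteristic zero, `m ≥ 1`) has a unique expansion
`Q p = ∑_k a_k · ∂^k p` over multi-indices `k`; the (formally finite) sum is a
`finsum`, which is legitimate since `∂^k p = 0` for all but finitely many `k`. -/
theorem mv_xd_expansion {K : Type*} [Field K] [CharZero K] {m : ℕ} (hm : 0 < m)
    (Q : Module.End K (MvPolynomial (Fin m) K)) :
    ∃! a : (Fin m → ℕ) → MvPolynomial (Fin m) K,
      ∀ p : MvPolynomial (Fin m) K,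
        Q p = ∑ᶠ k : Fin m → ℕ, a k * pderivPow k p := by
  exact ⟨expansionCoeff Q, fun p => (DFunLike.congr_fun (diffOperator_expansionCoeff Q) p).symm,
    fun b hb => diffOperator_injective <|
      (LinearMap.ext fun p => (hb p).symm).trans (diffOperator_expansionCoeff Q).symm⟩
end

section
/- Let K be a field of characteristic zero and let (a_k)_{k≥0} be a sequence of polynomials in K[x]. The formal sum of operators Σ_{k=0}^∞ D^k a_k(X) converges in the discrete topology — that is, for every polynomial p ∈ K[x] all but finitely many of the polynomials D^k(a_k · p) are zero — if and only if k − deg(a_k) tends to +∞ as k → ∞ (i.e., for every N there exists K₀ such that for all k ≥ K₀, either a_k = 0 or deg(a_k) ≤ k − N). -/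
/-- In characteristic zero, a nonzero polynomial killed by the `k`-th derivative has degree
less than `k`. -/
theorem Polynomial.natDegree_lt_of_iterate_derivative_eq_zero {R : Type*} [CommRing R]
    [IsDomain R] [CharZero R] {q : Polynomial R} {k : ℕ} (hq : q ≠ 0)
    (h : Polynomial.derivative^[k] q = 0) : q.natDegree < k := by
  by_contra! hk
  have hc := congrArg (fun r => Polynomial.coeff r (q.natDegree - k)) h
  simp only [Polynomial.coeff_iterate_derivative, Nat.sub_add_cancel hk, Polynomial.coeff_zero,
    nsmul_eq_mul, mul_eq_zero, Nat.cast_eq_zero, Nat.descFactorial_eq_zero_iff_lt] at hc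
  rcases hc with hc | hc
  · omega
  · exact hq (Polynomial.leadingCoeff_eq_zero.mp hc)


/-- **XD-convergence.**  The formal sum of operators `∑ₖ Dᵏ aₖ(X)` converges in the
discrete topology — for every polynomial `p` all but finitely many of the polynomials
`Dᵏ(aₖ·p)` vanish — iff `k − deg(aₖ) → +∞`, i.e. for every `N` there is `K₀` such
that for all `k ≥ K₀` either `aₖ = 0` or `deg(aₖ) ≤ k − N`. -/
theorem dk_ak_convergence {K : Type*} [Field K] [CharZero K] (a : ℕ → Polynomial K) :
    (∀ p : Polynomial K,
        {k : ℕ | Polynomial.derivative^[k] (a k * p) ≠ 0}.Finite) ↔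
      ∀ N : ℕ, ∃ K₀ : ℕ, ∀ k : ℕ, K₀ ≤ k →
        a k = 0 ∨ (a k).natDegree + N ≤ k := by
  constructor
  · intro h N
    obtain ⟨B, hB⟩ := (h (Polynomial.X ^ N)).bddAbove
    refine ⟨B + 1, fun k hk => or_iff_not_imp_left.mpr fun hak => ?_⟩
    have hz : Polynomial.derivative^[k] (a k * Polynomial.X ^ N) = 0 := by
      by_contra hne
      have : k ≤ B := hB hne
      omega
    have hlt := Polynomial.natDegree_lt_of_iterate_derivative_eq_zero
      (mul_ne_zero hak (pow_ne_zero N Polynomial.X_ne_zero)) hz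
    rw [Polynomial.natDegree_mul_X_pow N hak] at hlt
    exact hlt.le
  · intro h p
    obtain ⟨B, hB⟩ := h (p.natDegree + 1)
    refine (Set.finite_lt_nat B).subset fun k hk => ?_
    by_contra hkB
    apply hk
    rcases hB k (not_lt.mp hkB) with hak | hdeg
    · simp [hak]
    · apply Polynomial.iterate_derivative_eq_zero
      have := Polynomial.natDegree_mul_le (p := a k) (q := p)
      omega
end

section
/- Let K be a field of characteristic zero and let i, j be nonnegative integers. Then as linear operators on K[x], D^j X^i = Σ_{k=0}^{min(i,j)} ((i)_k (j)_k / k!) X^{i−k} D^{j−k}; that is, for every polynomial p, the j-th derivative of x^i · p equals Σ_{k=0}^{min(i,j)} ((i)_k (j)_k / k!) · x^{i−k} · p^{(j−k)}, where (m)_k = m(m−1)⋯(m−k+1) denotes the falling factorial. -/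
/-- **Commutation rule** `Dʲ Xⁱ = ∑_{k=0}^{min(i,j)} (i)ₖ (j)ₖ / k! · X^{i−k} D^{j−k}`:
for every polynomial `p`, the `j`-th derivative of `xⁱ·p` equals
`∑ₖ ((i)ₖ (j)ₖ / k!) · x^{i−k} · p^{(j−k)}`, where `(m)ₖ` is the falling factorial. -/
theorem dj_xi_commutation {K : Type*} [Field K] [CharZero K] (i j : ℕ)
    (p : Polynomial K) :
    Polynomial.derivative^[j] (Polynomial.X ^ i * p) =
      ∑ k ∈ Finset.range (min i j + 1),
        (((i.descFactorial k : K) * (j.descFactorial k : K)) / (k.factorial : K)) •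
          (Polynomial.X ^ (i - k) * Polynomial.derivative^[j - k] p) := by
  rw [mul_comm, Polynomial.iterate_derivative_mul_X_pow]
  refine Finset.sum_congr rfl fun k _ => ?_
  have hk : (k.factorial : K) ≠ 0 := Nat.cast_ne_zero.mpr k.factorial_ne_zero
  have hc : ((i.descFactorial k : K) * (j.descFactorial k : K)) / (k.factorial : K) =
      ((j.choose k * i.descFactorial k : ℕ) : K) := by
    rw [div_eq_iff hk, Nat.descFactorial_eq_factorial_mul_choose j k]
    push_cast
    ring
  rw [hc, Nat.cast_smul_eq_nsmul, mul_comm (Polynomial.X ^ (i - k))]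
end

section
/- Let K be a field of characteristic zero and let i, j be nonnegative integers. Then as linear operators on K[x], X^i D^j = Σ_{k=0}^{min(i,j)} (−1)^k ((i)_k (j)_k / k!) D^{j−k} X^{i−k}; that is, for every polynomial p, x^i · p^{(j)} equals Σ_{k=0}^{min(i,j)} (−1)^k ((i)_k (j)_k / k!) · (x^{i−k} · p)^{(j−k)}, where (m)_k = m(m−1)⋯(m−k+1) denotes the falling factorial. -/
namespace Polynomial

/-- Division-free form of the commutation rule, over any commutative ring. -/
theorem X_pow_mul_iterate_derivative {R : Type*} [CommRing R] (i j : ℕ) (p : R[X]) :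
    X ^ i * derivative^[j] p =
      ∑ k ∈ Finset.range (i + 1), (i.choose k : R[X]) *
        ((-1) ^ k * (j.descFactorial k : R[X]) * derivative^[j - k] (X ^ (i - k) * p)) := by
  induction i generalizing j p with
  | zero => simp
  | succ i ih =>
    have hX : X * derivative^[j] p =
        derivative^[j] (X * p) - (j : R[X]) * derivative^[j - 1] p := by
      rw [mul_comm X p, iterate_derivative_mul_X, nsmul_eq_mul]
      ring
    rw [Finset.sum_choose_succ_mul (fun k m => (-1) ^ k * (j.descFactorial k : R[X]) *
        derivative^[j - k] (X ^ m * p)) i, pow_succ, mul_assoc, hX, mul_sub, mul_left_comm, ih, ih,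
      sub_eq_add_neg, Finset.mul_sum, ← Finset.sum_neg_distrib]
    congr 1
    · refine Finset.sum_congr rfl fun k hk => ?_
      rw [← mul_assoc (X ^ (i - k)) X p, ← pow_succ,
        Nat.succ_sub (Nat.lt_succ_iff.mp (Finset.mem_range.mp hk))]
    · refine Finset.sum_congr rfl fun k _ => ?_
      have hj : (j.descFactorial (k + 1) : R[X]) = j * ((j - 1).descFactorial k : R[X]) := by
        cases j with
        | zero => simp
        | succ j => rw [Nat.succ_descFactorial_succ, Nat.cast_mul, Nat.add_sub_cancel]
      rw [hj, Nat.sub_sub, Nat.add_comm 1 k]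
      ring

end Polynomial


/-- **Commutation rule** `Xⁱ Dʲ = ∑_{k=0}^{min(i,j)} (−1)ᵏ (i)ₖ (j)ₖ / k! · D^{j−k} X^{i−k}`:
for every polynomial `p`, `xⁱ · p^{(j)}` equals
`∑ₖ (−1)ᵏ ((i)ₖ (j)ₖ / k!) · (x^{i−k}·p)^{(j−k)}`, where `(m)ₖ` is the falling factorial. -/
theorem xi_dj_commutation {K : Type*} [Field K] [CharZero K] (i j : ℕ)
    (p : Polynomial K) :
    Polynomial.X ^ i * Polynomial.derivative^[j] p =
      ∑ k ∈ Finset.range (min i j + 1),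
        ((-1 : K) ^ k * ((i.descFactorial k : K) * (j.descFactorial k : K)) / (k.factorial : K)) •
          Polynomial.derivative^[j - k] (Polynomial.X ^ (i - k) * p) := by
  rw [Polynomial.X_pow_mul_iterate_derivative]
  symm
  refine Finset.sum_subset_zero_on_sdiff (Finset.range_mono (by omega)) (fun k hk => ?_)
    (fun k _ => ?_)
  · have hjk : j < k := by
      simp only [Finset.mem_sdiff, Finset.mem_range] at hk
      omega
    simp [Nat.descFactorial_of_lt hjk]
  · have hk : (k.factorial : K) ≠ 0 := Nat.cast_ne_zero.mpr k.factorial_ne_zero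
    have hc : (-1 : K) ^ k * ((i.descFactorial k : K) * (j.descFactorial k : K)) /
        (k.factorial : K) = (i.choose k : K) * ((-1) ^ k * (j.descFactorial k : K)) := by
      rw [Nat.descFactorial_eq_factorial_mul_choose i k, Nat.cast_mul]
      field_simp
    rw [hc, Polynomial.smul_eq_C_mul]
    simp [mul_assoc]
end

section
/- Let K be a field of characteristic zero and let J be the formal integration operator on K[x], the linear operator determined by J x^n = x^{n+1}/(n+1) for all n ≥ 0 (so (J p)(0) = 0 and (J p)′ = p). Then for every polynomial p, J p = Σ_{n=0}^{deg p} (−1)^n · x^{n+1} · p^{(n)} / (n+1)!; i.e., J has the XD-expansion J = Σ_{n≥0} (−1)^n X^{n+1} D^n / (n+1)!. -/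
open Polynomial

/-- In characteristic zero, a polynomial is determined by its derivative and constant term. -/
theorem Polynomial.eq_of_derivative_eq_of_coeff_zero_eq {R : Type*} [Ring R] [CharZero R]
    [IsDomain R] {p q : R[X]} (hd : derivative p = derivative q)
    (h0 : p.coeff 0 = q.coeff 0) : p = q := by
  ext n
  cases n with
  | zero => exact h0
  | succ n =>
    have h := congrArg (fun r => r.coeff n) hd
    simp only [coeff_derivative] at h
    exact mul_right_cancel₀ (Nat.cast_add_one_ne_zero n) h

/-- The derivative of the truncated expansion telescopes. -/
theorem Polynomial.derivative_sum_range_X_pow_mul_iterate_derivative {K : Type*} [Field K]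
    [CharZero K] (p : K[X]) (N : ℕ) :
    derivative (∑ n ∈ Finset.range N,
        ((-1 : K) ^ n / ((n + 1).factorial : K)) • (X ^ (n + 1) * derivative^[n] p)) =
      p - ((-1 : K) ^ N / (N.factorial : K)) • (X ^ N * derivative^[N] p) := by
  induction N with
  | zero => simp
  | succ N ih =>
    have hN : (N.factorial : K) ≠ 0 := Nat.cast_ne_zero.mpr N.factorial_ne_zero
    have hN1 : (N : K) + 1 ≠ 0 := Nat.cast_add_one_ne_zero N
    have hc : (-1 : K) ^ N / ((N + 1).factorial : K) * ((N : K) + 1) =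
        (-1) ^ N / (N.factorial : K) := by
      rw [Nat.factorial_succ]
      push_cast
      field_simp
    have hs : (-1 : K) ^ (N + 1) / ((N + 1).factorial : K) =
        -((-1) ^ N / ((N + 1).factorial : K)) := by
      rw [pow_succ]
      ring
    rw [Finset.sum_range_succ, derivative_add, ih, derivative_smul, derivative_mul,
      derivative_X_pow, Function.iterate_succ_apply', hs, ← hc]
    simp only [smul_eq_C_mul, C_mul, C_neg, C_add, Nat.cast_add, Nat.cast_one, C_1,
      Nat.add_sub_cancel]
    ring


/-- **XD-expansion of the integration operator.**  Let `J` be the formal integration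
operator on `K[x]`, determined by `J xⁿ = xⁿ⁺¹/(n+1)`.  Then for every polynomial `p`,
`J p = ∑_{n=0}^{deg p} (−1)ⁿ · xⁿ⁺¹ · p⁽ⁿ⁾ / (n+1)!`; i.e.
`J = ∑ₙ (−1)ⁿ Xⁿ⁺¹ Dⁿ / (n+1)!`. -/
theorem integration_xd_expansion {K : Type*} [Field K] [CharZero K]
    (J : Module.End K (Polynomial K))
    (hJ : ∀ n : ℕ, J (Polynomial.X ^ n) = ((n : K) + 1)⁻¹ • Polynomial.X ^ (n + 1)) :
    ∀ p : Polynomial K,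
      J p = ∑ n ∈ Finset.range (p.natDegree + 1),
        ((-1 : K) ^ n / ((n + 1).factorial : K)) •
          (Polynomial.X ^ (n + 1) * Polynomial.derivative^[n] p) := by
  intro p
  have hderiv : derivative ∘ₗ J = LinearMap.id := by
    ext1 n
    refine LinearMap.ext_ring ?_
    have hn : (n : K) + 1 ≠ 0 := Nat.cast_add_one_ne_zero n
    simp [monomial_one_right_eq_X_pow, hJ, smul_eq_C_mul, ← mul_assoc,
      ← C_mul, inv_mul_cancel₀ hn, -map_add, -map_mul, -map_inv₀]
  have hcoeff : lcoeff K 0 ∘ₗ J = 0 := by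
    ext1 n
    refine LinearMap.ext_ring ?_
    simp [monomial_one_right_eq_X_pow, hJ]
  refine eq_of_derivative_eq_of_coeff_zero_eq ?_ ?_
  · rw [derivative_sum_range_X_pow_mul_iterate_derivative,
      iterate_derivative_eq_zero (Nat.lt_succ_self _), mul_zero, smul_zero, sub_zero]
    exact LinearMap.congr_fun hderiv p
  · have h := LinearMap.congr_fun hcoeff p
    simp only [LinearMap.comp_apply, lcoeff_apply, LinearMap.zero_apply] at h
    simp [h, mul_coeff_zero]
end

section
/- Let K be a field of characteristic zero and let B be a degree reducing linear operator on K[x]. Then there exists a unique sequence of polynomials (b_n)_{n≥0} in K[x] such that B b_0 = 0, B b_n = b_{n−1} for all n ≥ 1, and b_n(0) = δ_{n0} for all n; moreover b_n has degree n for every n (so (b_n) is a basis of K[x]). -/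
namespace DegreeReducing

variable {K : Type*} [Field K] {B : Module.End K (Polynomial K)}

open Polynomial

theorem degree_pos_of_apply_ne_zero (hB : DegreeReducing B) {p : K[X]} (hp : B p ≠ 0) :
    0 < p.degree := by
  by_contra! h
  rw [eq_C_of_degree_le_zero h] at hp
  exact hp (hB.1 _)

theorem eq_C_of_apply_eq_zero_s18 (hB : DegreeReducing B) {p : K[X]} (hp : B p = 0) :
    p = C (p.eval 0) := by
  by_cases h : 0 < p.degree
  · have h' := hB.2 p h
    rw [hp, degree_zero, WithBot.bot_add] at h'
    simp [← h'] at h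
  · rw [← coeff_zero_eq_eval_zero]
    exact eq_C_of_degree_le_zero (not_lt.mp h)

theorem eq_of_apply_eq (hB : DegreeReducing B) {p q : K[X]} (h : B p = B q)
    (h0 : p.eval 0 = q.eval 0) : p = q := by
  have := hB.eq_C_of_apply_eq_zero_s18 (p := p - q) (by rw [map_sub, h, sub_self])
  rwa [eval_sub, h0, sub_self, C_0, sub_eq_zero] at this

theorem degree_apply_X_pow_succ (hB : DegreeReducing B) (n : ℕ) :
    (B (X ^ (n + 1))).degree = n := by
  have h := hB.2 (X ^ (n + 1)) (by rw [degree_X_pow]; exact_mod_cast n.succ_pos)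
  rw [degree_X_pow, Nat.cast_add, Nat.cast_one] at h
  exact WithBot.add_right_cancel (by simp) h

theorem surjective (hB : DegreeReducing B) : Function.Surjective B := by
  have key : ∀ (n : ℕ) (q : K[X]), q.degree < n → ∃ p, B p = q := by
    intro n
    induction n with
    | zero =>
      intro q hq
      refine ⟨0, ?_⟩
      rw [map_zero]
      refine (Polynomial.ext fun m => ?_).symm
      exact (degree_lt_iff_coeff_zero q 0).mp hq m m.zero_le
    | succ n ih =>
      intro q hq
      set r := B (X ^ (n + 1)) with hr
      have hd : r.degree = n := hB.degree_apply_X_pow_succ n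
      have hrn : r.coeff n ≠ 0 := coeff_ne_zero_of_eq_degree hd
      obtain ⟨p, hp⟩ := ih (q - (q.coeff n / r.coeff n) • r) <| by
        rw [degree_lt_iff_coeff_zero]
        intro m hm
        rcases hm.eq_or_lt with rfl | hm
        · simp [hrn]
        · have h1 : q.coeff m = 0 := (degree_lt_iff_coeff_zero q (n + 1)).mp hq m hm
          have h2 : r.coeff m = 0 :=
            coeff_eq_zero_of_degree_lt (by rw [hd]; exact_mod_cast hm)
          simp [h1, h2]
      exact ⟨p + (q.coeff n / r.coeff n) • X ^ (n + 1), by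
        rw [map_add, map_smul, hp, ← hr, sub_add_cancel]⟩
  intro q
  exact key (q.natDegree + 1) q
    (degree_le_natDegree.trans_lt (by exact_mod_cast q.natDegree.lt_succ_self))

theorem exists_apply_eq_and_eval_zero (hB : DegreeReducing B) (q : K[X]) :
    ∃ p, B p = q ∧ p.eval 0 = 0 := by
  obtain ⟨p, hp⟩ := hB.surjective q
  exact ⟨p - C (p.eval 0), by rw [map_sub, hB.1, sub_zero, hp], by simp⟩

theorem exists_isDividedPowerSeq (hB : DegreeReducing B) : ∃ b, IsDividedPowerSeq B b := by
  choose f hf hf0 using hB.exists_apply_eq_and_eval_zero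
  refine ⟨fun n => f^[n] 1, ?_, fun n => ?_, fun n => ?_⟩
  · simpa using hB.1 1
  · simp only [Function.iterate_succ_apply', hf]
  · cases n with
    | zero => simp
    | succ n => simp only [Function.iterate_succ_apply', hf0, Nat.succ_ne_zero, if_false]

theorem isDividedPowerSeq_unique (hB : DegreeReducing B) {b c : ℕ → K[X]}
    (hb : IsDividedPowerSeq B b) (hc : IsDividedPowerSeq B c) : b = c := by
  funext n
  induction n with
  | zero => exact hB.eq_of_apply_eq (hb.1.trans hc.1.symm) ((hb.2.2 0).trans (hc.2.2 0).symm)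
  | succ n ih =>
    refine hB.eq_of_apply_eq ?_ ((hb.2.2 _).trans (hc.2.2 _).symm)
    rw [hb.2.1, hc.2.1, ih]

theorem degree_isDividedPowerSeq (hB : DegreeReducing B) {b : ℕ → K[X]}
    (hb : IsDividedPowerSeq B b) (n : ℕ) : (b n).degree = n := by
  induction n with
  | zero =>
    rw [hB.eq_C_of_apply_eq_zero_s18 hb.1, hb.2.2]
    simp
  | succ n ih =>
    have hn : B (b (n + 1)) ≠ 0 := by
      rw [hb.2.1]
      rintro h
      simp [h] at ih
    rw [← hB.2 _ (hB.degree_pos_of_apply_ne_zero hn), hb.2.1, ih, Nat.cast_add, Nat.cast_one]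

end DegreeReducing

/-- Every degree reducing operator `B` on `K[x]` has a unique divided power sequence
`(bₙ)` (with `B b₀ = 0`, `B bₙ = bₙ₋₁`, `bₙ(0) = δₙ₀`); moreover `bₙ` has degree `n`
for every `n` (so the `bₙ` form a basis of `K[x]`). -/
theorem divided_power_sequence_exists_unique {K : Type*} [Field K] [CharZero K]
    (B : Module.End K (Polynomial K)) (hB : DegreeReducing B) :
    (∃! b : ℕ → Polynomial K, IsDividedPowerSeq B b) ∧
      ∀ b : ℕ → Polynomial K, IsDividedPowerSeq B b →
        ∀ n : ℕ, (b n).degree = (n : WithBot ℕ) := by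
  obtain ⟨b, hb⟩ := hB.exists_isDividedPowerSeq
  exact ⟨⟨b, hb, fun _ hc => hB.isDividedPowerSeq_unique hc hb⟩,
    fun _ hc => hB.degree_isDividedPowerSeq hc⟩
end
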